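/- Let Λ be a row-finite k-graph with no sources and let H ⊆ Λ⁰ be hereditary. Suppose λ, μ ∈ Λ satisfy r(λ), r(μ) ∈ H, s(λ) = s(μ) =: w, and λ·x = μ·x for every infinite path x ∈ wΛ^∞. Then σ^{d(λ)}(x) = σ^{d(μ)}(x) for every x ∈ wΛ^∞; in particular d(λ) − d(μ) belongs to the periodicity group Per(Λ) := { d(α) − d(β) : α, β ∈ Λ, s(α) = s(β), and α·x = β·x for all x ∈ s(α)Λ^∞ }. -/

import Mathlib

/-- A `k`-graph: a countable small category `Λ` (with morphism set `Mor`, range map `r`,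
source map `s` and composition `comp`; the objects/vertices are identified with the
identity morphisms, which are exactly the morphisms of degree `0`) together with a degree
functor `d : Λ → ℕ^k` satisfying the factorisation property. -/
structure KGraph (k : ℕ) where
  /-- The set of morphisms. -/
  Mor : Type
  /-- A `k`-graph is countable. -/
  countable : Countable Mor
  /-- The degree functor `d : Λ → ℕ^k`. -/
  d : Mor → Fin k → ℕ
  /-- The range (codomain) of a morphism, as an identity morphism. -/
  r : Mor → Mor
  /-- The source (domain) of a morphism, as an identity morphism. -/
  s : Mor → Mor
  /-- Composition `μν` of morphisms with `s μ = r ν`. -/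
  comp : (μ ν : Mor) → s μ = r ν → Mor
  d_r : ∀ lam, d (r lam) = 0
  d_s : ∀ lam, d (s lam) = 0
  r_vertex : ∀ v, d v = 0 → r v = v
  s_vertex : ∀ v, d v = 0 → s v = v
  r_comp : ∀ μ ν h, r (comp μ ν h) = r μ
  s_comp : ∀ μ ν h, s (comp μ ν h) = s ν
  d_comp : ∀ μ ν h, d (comp μ ν h) = d μ + d ν
  comp_assoc : ∀ lam μ ν (h₁ : s lam = r μ) (h₂ : s μ = r ν) h₃ h₄,
    comp (comp lam μ h₁) ν h₃ = comp lam (comp μ ν h₂) h₄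
  id_comp : ∀ lam, comp (r lam) lam (s_vertex (r lam) (d_r lam)) = lam
  comp_id : ∀ lam, comp lam (s lam) (Eq.symm (r_vertex (s lam) (d_s lam))) = lam
  /-- The factorisation property. -/
  factor : ∀ (lam : Mor) (m n : Fin k → ℕ), d lam = m + n →
    ∃! μν : Mor × Mor, ∃ h : s μν.1 = r μν.2,
      d μν.1 = m ∧ d μν.2 = n ∧ comp μν.1 μν.2 h = lam

namespace KGraph

variable {k : ℕ} (Λ : KGraph k)

/-- The vertices of a `k`-graph: the morphisms of degree `0`. -/
def vertices : Set Λ.Mor := {v | Λ.d v = 0}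

/-- `Λ` is row-finite if each vertex receives finitely many paths of each degree. -/
def RowFinite : Prop :=
  ∀ v n, Λ.d v = 0 → {lam : Λ.Mor | Λ.r lam = v ∧ Λ.d lam = n}.Finite

/-- `Λ` has no sources if every vertex receives an edge of each of the `k` colours. -/
def NoSources : Prop :=
  ∀ v, Λ.d v = 0 → ∀ i : Fin k, ∃ e : Λ.Mor, Λ.r e = v ∧ Λ.d e = Pi.single i 1

/-- An infinite path in `Λ`: a degree-preserving functor `x : Ω_k → Λ`, recorded by its
segments `x(m, n)` for `m ≤ n` in `ℕ^k`. -/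
structure InfPath where
  /-- The segment `x(m,n)` of the path, for `m ≤ n`. -/
  seg : (m n : Fin k → ℕ) → m ≤ n → Λ.Mor
  deg_seg : ∀ m n h, Λ.d (seg m n h) = fun i => n i - m i
  r_seg : ∀ m n h, Λ.r (seg m n h) = seg m m le_rfl
  s_seg : ∀ m n h, Λ.s (seg m n h) = seg n n le_rfl
  comp_seg : ∀ m n p (h₁ : m ≤ n) (h₂ : n ≤ p),
    seg m p (h₁.trans h₂) =
      Λ.comp (seg m n h₁) (seg n p h₂) (by rw [s_seg, r_seg])

variable {Λ}

/-- The shift `σ^p x` of an infinite path. -/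
def InfPath.shift (x : Λ.InfPath) (p : Fin k → ℕ) : Λ.InfPath where
  seg m n h := x.seg (m + p) (n + p) (fun i => Nat.add_le_add_right (h i) (p i))
  deg_seg m n h := by
    rw [x.deg_seg]
    funext i
    simp only [Pi.add_apply]
    omega
  r_seg m n h := x.r_seg _ _ _
  s_seg m n h := x.s_seg _ _ _
  comp_seg m n p h₁ h₂ := x.comp_seg _ _ _ _ _

/-- The range `r(x) = x(0)` of an infinite path. -/
def InfPath.range (x : Λ.InfPath) : Λ.Mor := x.seg 0 0 le_rfl

/-- The vertex `x(p)` of an infinite path. -/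
def InfPath.vertex (x : Λ.InfPath) (p : Fin k → ℕ) : Λ.Mor := x.seg p p le_rfl


variable (Λ)

/-- `Λ.Prepends lam x y` says that `y = λ·x`: the initial segment `y(0, d(λ))` is `λ` and
`σ^{d(λ)}(y) = x`. -/
def Prepends (lam : Λ.Mor) (x y : Λ.InfPath) : Prop :=
  y.seg 0 (Λ.d lam) (fun i => Nat.zero_le _) = lam ∧ y.shift (Λ.d lam) = x

/-- A subset `H ⊆ Λ⁰` is hereditary if `s(λ) ∈ H` whenever `r(λ) ∈ H`. -/
def Hereditary (H : Set Λ.Mor) : Prop := ∀ lam, Λ.r lam ∈ H → Λ.s lam ∈ H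

/-- The periodicity group
`Per(Λ) = { d(α) − d(β) : s(α) = s(β) and α·x = β·x for all x ∈ s(α)Λ^∞ }`,
as a subset of `ℤ^k`. -/
def Per : Set (Fin k → ℤ) :=
  {g | ∃ α β : Λ.Mor, Λ.s α = Λ.s β ∧
    (∀ x : Λ.InfPath, x.range = Λ.s α →
      ∀ y z, Λ.Prepends α x y → Λ.Prepends β x z → y = z) ∧
    g = fun i => (Λ.d α i : ℤ) - (Λ.d β i : ℤ)}

variable {Λ}

theorem comp_left_cancel {a b c : Λ.Mor} (h : Λ.s a = Λ.r b) (h' : Λ.s a = Λ.r c)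
    (e : Λ.comp a b h = Λ.comp a c h') : b = c := by
  have hd : Λ.d b = Λ.d c := by
    have := congrArg Λ.d e
    rw [Λ.d_comp, Λ.d_comp] at this
    exact add_left_cancel this
  have := (Λ.factor (Λ.comp a c h') (Λ.d a) (Λ.d c) (Λ.d_comp _ _ _)).unique
    (y₁ := (a, b)) (y₂ := (a, c)) ⟨h, rfl, hd, e⟩ ⟨h', rfl, rfl, rfl⟩
  exact congrArg Prod.snd this

/-- `a` is an initial segment of `p`. -/
def IsInitial (a p : Λ.Mor) : Prop := ∃ (b : Λ.Mor) (h : Λ.s a = Λ.r b), Λ.comp a b h = p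

theorem IsInitial.comp (a b : Λ.Mor) (h : Λ.s a = Λ.r b) : IsInitial a (Λ.comp a b h) :=
  ⟨b, h, rfl⟩

theorem IsInitial.trans {a p q : Λ.Mor} (h₁ : IsInitial a p) (h₂ : IsInitial p q) :
    IsInitial a q := by
  obtain ⟨b, hb, rfl⟩ := h₁
  obtain ⟨c, hc, rfl⟩ := h₂
  have hbc : Λ.s b = Λ.r c := by rw [← hc, Λ.s_comp]
  have h : Λ.s a = Λ.r (Λ.comp b c hbc) := by rw [Λ.r_comp, hb]
  exact ⟨_, h, (Λ.comp_assoc _ _ _ _ _ _ _).symm⟩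

theorem IsInitial.eq_of_d_eq {a b p : Λ.Mor} (ha : IsInitial a p) (hb : IsInitial b p)
    (hd : Λ.d a = Λ.d b) : a = b := by
  obtain ⟨a', h, rfl⟩ := ha
  obtain ⟨b', h', e⟩ := hb
  have hd' : Λ.d b' = Λ.d a' := by
    have := congrArg Λ.d e
    rw [Λ.d_comp, Λ.d_comp, hd] at this
    exact add_left_cancel this
  have := (Λ.factor (Λ.comp a a' h) (Λ.d a) (Λ.d a') (Λ.d_comp _ _ _)).unique
    (y₁ := (a, a')) (y₂ := (b, b')) ⟨h, rfl, rfl, rfl⟩ ⟨h', hd.symm, hd', e⟩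
  exact congrArg Prod.fst this

theorem exists_isInitial (p : Λ.Mor) {n : Fin k → ℕ} (hn : n ≤ Λ.d p) :
    ∃ a, IsInitial a p ∧ Λ.d a = n := by
  obtain ⟨⟨a, b⟩, ⟨h, ha, -, e⟩, -⟩ :=
    Λ.factor p n (Λ.d p - n) (add_tsub_cancel_of_le hn).symm
  exact ⟨a, ⟨b, h, e⟩, ha⟩

theorem IsInitial.of_d_le {a b p : Λ.Mor} (ha : IsInitial a p) (hb : IsInitial b p)
    (hd : Λ.d a ≤ Λ.d b) : IsInitial a b := by
  obtain ⟨c, hc, hcd⟩ := exists_isInitial b hd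
  rwa [← (hc.trans hb).eq_of_d_eq ha hcd]

namespace InfPath

theorem ext_seg {x y : Λ.InfPath} (h : ∀ m n hmn, x.seg m n hmn = y.seg m n hmn) : x = y := by
  cases x
  cases y
  congr
  funext m n hmn
  exact h m n hmn

theorem seg_congr (x : Λ.InfPath) {m m' n n' : Fin k → ℕ} (hm : m = m') (hn : n = n')
    (h : m ≤ n) (h' : m' ≤ n') : x.seg m n h = x.seg m' n' h' := by
  subst hm hn
  rfl

theorem shift_shift_comm (x : Λ.InfPath) (p q : Fin k → ℕ) :
    (x.shift p).shift q = (x.shift q).shift p :=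
  ext_seg fun _ _ _ => x.seg_congr (add_right_comm _ _ _) (add_right_comm _ _ _) _ _

theorem d_seg_zero (x : Λ.InfPath) (n : Fin k → ℕ) :
    Λ.d (x.seg 0 n fun _ => Nat.zero_le _) = n := by
  rw [x.deg_seg]
  funext i
  simp

/-- The infinite path whose initial segments form a given coherent family. -/
theorem exists_of_isInitial (f : (Fin k → ℕ) → Λ.Mor) (hd : ∀ n, Λ.d (f n) = n)
    (hf : ∀ m n, m ≤ n → IsInitial (f m) (f n)) :
    ∃ y : Λ.InfPath, ∀ m n (hmn : m ≤ n),
      ∃ h : Λ.s (f m) = Λ.r (y.seg m n hmn), Λ.comp (f m) (y.seg m n hmn) h = f n := by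
  choose t ht e using hf
  have ht_self (m) : t m m le_rfl = Λ.s (f m) := by
    refine comp_left_cancel (ht _ _ _) (Λ.r_vertex _ (Λ.d_s _)).symm ?_
    rw [e, Λ.comp_id]
  have hs (m n h) : Λ.s (t m n h) = Λ.s (f n) := by
    rw [← Λ.s_comp (f m) (t m n h) (ht m n h), e]
  refine ⟨⟨t, ?_, ?_, ?_, ?_⟩, fun m n hmn => ⟨ht m n hmn, e m n hmn⟩⟩
  · intro m n h
    have := congrArg Λ.d (e m n h)
    rw [Λ.d_comp, hd, hd] at this
    funext i
    have := congrFun this i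
    simp only [Pi.add_apply] at this
    omega
  · intro m n h
    rw [ht_self, ht m n h]
  · intro m n h
    rw [ht_self, hs]
  · intro m n p h₁ h₂
    have hc : Λ.s (t m n h₁) = Λ.r (t n p h₂) := by rw [hs, ht n p h₂]
    refine comp_left_cancel (ht _ _ _) (by rw [Λ.r_comp, ht m n h₁]) ?_
    rw [e, ← Λ.comp_assoc _ _ _ (ht m n h₁) hc (by rw [Λ.s_comp, hc])]
    simp only [e]

end InfPath

theorem exists_prepends (a : Λ.Mor) (x : Λ.InfPath) (hx : x.range = Λ.s a) :
    ∃ y, Λ.Prepends a x y := by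
  have hr (n : Fin k → ℕ) : Λ.s a = Λ.r (x.seg 0 n fun _ => Nat.zero_le _) := by
    rw [x.r_seg, ← hx, InfPath.range]
  let g (n : Fin k → ℕ) : Λ.Mor := Λ.comp a (x.seg 0 n fun _ => Nat.zero_le _) (hr n)
  have hgd (n) : Λ.d (g n) = Λ.d a + n := by rw [Λ.d_comp, x.d_seg_zero]
  have hgc (m n) (h : m ≤ n) :
      ∃ h' : Λ.s (g m) = Λ.r (x.seg m n h), Λ.comp (g m) (x.seg m n h) h' = g n := by
    have h' : Λ.s (g m) = Λ.r (x.seg m n h) := by rw [Λ.s_comp, x.s_seg, x.r_seg]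
    refine ⟨h', ?_⟩
    simp only [g, x.comp_seg 0 m n (fun _ => Nat.zero_le _) h]
    exact Λ.comp_assoc _ _ _ _ _ _ _
  have hg (m n) (h : m ≤ n) : IsInitial (g m) (g n) := ⟨_, hgc m n h⟩
  choose f hfi hfd using fun n => exists_isInitial (g n) (n := n) (by rw [hgd]; exact le_add_self)
  obtain ⟨y, hy⟩ := InfPath.exists_of_isInitial f hfd fun m n h =>
    ((hfi m).trans (hg m n h)).of_d_le (hfi n) (by rwa [hfd, hfd])
  have hfa : f (Λ.d a) = a :=
    (hfi _).eq_of_d_eq (IsInitial.comp _ _ _) (hfd _)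
  have hfg (n) : f (n + Λ.d a) = g n :=
    (hfi _).eq_of_d_eq (hg n _ le_self_add) (by rw [hfd, hgd, add_comm])
  refine ⟨y, ?_, InfPath.ext_seg fun m n h => ?_⟩
  · obtain ⟨h, e⟩ := hy 0 (Λ.d a) fun _ => Nat.zero_le _
    have h0 : f 0 = Λ.r (y.seg 0 (Λ.d a) fun _ => Nat.zero_le _) := by
      rw [← h, Λ.s_vertex _ (hfd 0)]
    rw [← Λ.id_comp (y.seg 0 (Λ.d a) fun _ => Nat.zero_le _)]
    simp only [← h0]
    rw [e, hfa]
  · obtain ⟨h₁, e₁⟩ := hy (m + Λ.d a) (n + Λ.d a) (fun i => Nat.add_le_add_right (h i) _)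
    obtain ⟨h₂, e₂⟩ := hgc m n h
    simp only [hfg] at h₁ e₁
    exact comp_left_cancel h₁ h₂ (e₁.trans e₂.symm)

variable (Λ)

/-- Let `Λ` be a row-finite `k`-graph with no sources and `H ⊆ Λ⁰`
hereditary.  Suppose `λ, μ ∈ Λ` satisfy `r(λ), r(μ) ∈ H`, `s(λ) = s(μ) = w`, and
`λ·x = μ·x` for every infinite path `x ∈ wΛ^∞`.  Then `σ^{d(λ)}(x) = σ^{d(μ)}(x)` for
every `x ∈ wΛ^∞`; in particular `d(λ) − d(μ) ∈ Per(Λ)`. -/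
theorem shift_eq_of_prepend_eq
    {k : ℕ} (Λ : KGraph k) (hrf : Λ.RowFinite) (hns : Λ.NoSources)
    (H : Set Λ.Mor) (hHsub : H ⊆ Λ.vertices) (hher : Λ.Hereditary H)
    (lam mu : Λ.Mor) (hrlam : Λ.r lam ∈ H) (hrmu : Λ.r mu ∈ H)
    (hs : Λ.s lam = Λ.s mu)
    (hagree : ∀ x : Λ.InfPath, x.range = Λ.s lam →
      ∀ y z, Λ.Prepends lam x y → Λ.Prepends mu x z → y = z) :
    (∀ x : Λ.InfPath, x.range = Λ.s lam → x.shift (Λ.d lam) = x.shift (Λ.d mu)) ∧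
    (fun i => (Λ.d lam i : ℤ) - (Λ.d mu i : ℤ)) ∈ Λ.Per := by
  refine ⟨fun x hx => ?_, lam, mu, hs, hagree, rfl⟩
  obtain ⟨y, hy⟩ := exists_prepends lam x hx
  obtain ⟨z, hz⟩ := exists_prepends mu x (hx.trans hs)
  obtain rfl := hagree x hx y z hy hz
  calc x.shift (Λ.d lam) = (y.shift (Λ.d mu)).shift (Λ.d lam) := by rw [hz.2]
    _ = (y.shift (Λ.d lam)).shift (Λ.d mu) := y.shift_shift_comm _ _
    _ = x.shift (Λ.d mu) := by rw [hy.2]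

end KGraph
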